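/- The normalization constant z = Σ_{λ∈Λ} d_λ · q^{−λ₁(λ₁+1)−λ₂(λ₂−1)} · (q^{n_λ+1} − q^{−n_λ−1})/(q − q^{−1}) satisfies z = −q³ · G_{N−1}⁴ / N². In particular z is independent of the choice of the parameters x₁, …, x_{N−1}. -/

import Mathlib

open Finset

noncomputable section

/-- `q = exp(2πi/N)`. -/
def qRoot (N : ℕ) : ℂ := Complex.exp (2 * Real.pi * Complex.I / N)

/-- The Gauss sum `G_k = Σ_{ν=0}^{N-1} q^{kν²}`. -/
def gauss (N : ℕ) (k : ℤ) : ℂ := ∑ ν ∈ range N, qRoot N ^ (k * (ν : ℤ) ^ 2)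

/-- `n_λ = (λ₁ - λ₂) mod N ∈ {0,…,N-1}`. -/
def nwt (N : ℕ) (lam : ℕ × ℕ) : ℕ := ((((lam.1 : ℤ) - (lam.2 : ℤ)) % (N : ℤ))).toNat

/-- `Λ = {λ ∈ {0,…,N-1}² : n_λ ≠ N-1}`, indexing the irreducible
highest-weight `U_q(gl(2))`-modules of nonzero `q`-dimension. -/
def LamSet (N : ℕ) : Finset (ℕ × ℕ) :=
  (range N ×ˢ range N).filter fun lam => nwt N lam ≠ N - 1

/-- The constants
`d_λ = q^{(N²+1)/2}·(G_{N-1}/N)²·q^{-λ₁(λ₁+1)-λ₂(λ₂-1)}·(q^{λ₁²+λ₂²} + x_{n_λ+1} + x_{N-n_λ-1})`,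
depending on arbitrary complex parameters `x₁, …, x_{N-1}`. -/
def dconst (N : ℕ) (x : ℕ → ℂ) (lam : ℕ × ℕ) : ℂ :=
  qRoot N ^ (((N ^ 2 + 1) / 2 : ℕ)) * (gauss N ((N : ℤ) - 1) / (N : ℂ)) ^ 2 *
    qRoot N ^ (-(lam.1 : ℤ) * ((lam.1 : ℤ) + 1) - (lam.2 : ℤ) * ((lam.2 : ℤ) - 1)) *
    (qRoot N ^ ((lam.1 : ℤ) ^ 2 + (lam.2 : ℤ) ^ 2) + x (nwt N lam + 1) + x (N - nwt N lam - 1))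

theorem qRoot_zpow (N : ℕ) [NeZero N] (k : ℤ) :
    qRoot N ^ k = ZMod.stdAddChar (k : ZMod N) := by
  rw [ZMod.stdAddChar_coe, qRoot, ← Complex.exp_int_mul]
  congr 1
  ring

theorem qRoot_pow (N : ℕ) [NeZero N] (k : ℕ) :
    qRoot N ^ k = ZMod.stdAddChar (k : ZMod N) := by
  simpa using qRoot_zpow N k

theorem nwt_eq_val (N : ℕ) [NeZero N] (lam : ℕ × ℕ) :
    nwt N lam = ((lam.1 : ZMod N) - (lam.2 : ZMod N)).val := by
  have h := ZMod.val_intCast (n := N) ((lam.1 : ℤ) - (lam.2 : ℤ))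
  rw [nwt, ← h, Int.toNat_natCast]
  push_cast
  rfl

theorem sum_range_eq_sum_zmod {M : Type*} [AddCommMonoid M] (N : ℕ) [NeZero N] (F : ZMod N → M) :
    ∑ ν ∈ range N, F (ν : ZMod N) = ∑ a, F a := by
  refine (sum_bij (fun a _ => ZMod.val a) (fun a _ => mem_range.2 a.val_lt)
    (fun a _ b _ h => ZMod.val_injective N h) (fun ν hν => ⟨(ν : ZMod N), mem_univ _, ?_⟩)
    (fun a _ => ?_)).symm
  · exact ZMod.val_cast_of_lt (mem_range.1 hν)
  · rw [ZMod.natCast_zmod_val]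

theorem gauss_neg_one_eq (N : ℕ) [NeZero N] :
    gauss N ((N : ℤ) - 1) = ∑ a : ZMod N, ZMod.stdAddChar (-a ^ 2) := by
  rw [← sum_range_eq_sum_zmod, gauss]
  refine sum_congr rfl fun ν _ => ?_
  rw [qRoot_zpow]
  simp

section CharacterSums

variable {R : Type*} [CommRing R] [Fintype R] (e : AddChar R ℂ)

/-- Completing the square in a quadratic Gauss sum over a ring in which `2` is invertible. -/
theorem sum_char_quadratic {h : R} (hh : 2 * h = 1) (c : R) :
    ∑ a, e (-a ^ 2 - c * a) = e ((c * h) ^ 2) * ∑ a, e (-a ^ 2) := by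
  rw [mul_sum, ← Equiv.sum_comp (Equiv.addRight (c * h))
    (fun a => e ((c * h) ^ 2) * e (-a ^ 2))]
  refine sum_congr rfl fun a _ => ?_
  rw [← AddChar.map_add_eq_mul, Equiv.coe_addRight]
  congr 1
  linear_combination c * a * hh

/-- The contribution of an even function vanishes by the reflection `(a, b) ↦ (b - 1, a + 1)`. -/
theorem sum_char_mul_even_eq_zero (y : R → ℂ) (hy : ∀ m ≠ 0, y (-m) = y m) :
    ∑ p : R × R, e (-p.1 * (p.1 + 1) - p.2 * (p.2 - 1)) ^ 2 * y (p.1 - p.2 + 1) *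
      (e (p.1 - p.2 + 1) - e (-(p.1 - p.2 + 1))) = 0 := by
  let σ : R × R ≃ R × R :=
    { toFun := fun p => (p.2 - 1, p.1 + 1)
      invFun := fun p => (p.2 - 1, p.1 + 1)
      left_inv := fun p => by simp
      right_inv := fun p => by simp }
  rw [← self_eq_neg, ← sum_neg_distrib]
  refine (Equiv.sum_comp σ _).symm.trans (sum_congr rfl fun p _ => ?_)
  have h₁ : -(p.2 - 1) * (p.2 - 1 + 1) - (p.1 + 1) * (p.1 + 1 - 1) =
      -p.1 * (p.1 + 1) - p.2 * (p.2 - 1) := by ring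
  have h₂ : p.2 - 1 - (p.1 + 1) + 1 = -(p.1 - p.2 + 1) := by ring
  simp only [σ, Equiv.coe_fn_mk, h₁, h₂, neg_neg]
  by_cases hm : p.1 - p.2 + 1 = 0
  · simp [hm]
  · rw [hy _ hm]
    ring

theorem sum_char_mul_char {h : R} (hh : 2 * h = 1) :
    ∑ p : R × R, e (-p.1 * (p.1 + 1) - p.2 * (p.2 - 1)) ^ 2 * e (p.1 ^ 2 + p.2 ^ 2) *
      (e (p.1 - p.2 + 1) - e (-(p.1 - p.2 + 1))) =
    -e (2 + h) * (e 1 - e (-1)) * (∑ a, e (-a ^ 2)) ^ 2 := by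
  have key (c d : R) : ∑ p : R × R, e d * (e (-p.1 ^ 2 - c * p.1) * e (-p.2 ^ 2 - -c * p.2)) =
      e (d + c ^ 2 * h) * (∑ a, e (-a ^ 2)) ^ 2 := by
    have hd : d + c ^ 2 * h = d + (c * h) ^ 2 + (-c * h) ^ 2 := by
      linear_combination (-c ^ 2 * h) * hh
    rw [← mul_sum, Fintype.sum_prod_type]
    simp only [← mul_sum, ← sum_mul]
    rw [sum_char_quadratic e hh, sum_char_quadratic e hh, hd, AddChar.map_add_eq_mul,
      AddChar.map_add_eq_mul]
    ring
  have split (p : R × R) : e (-p.1 * (p.1 + 1) - p.2 * (p.2 - 1)) ^ 2 * e (p.1 ^ 2 + p.2 ^ 2) *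
      (e (p.1 - p.2 + 1) - e (-(p.1 - p.2 + 1))) =
      e 1 * (e (-p.1 ^ 2 - 1 * p.1) * e (-p.2 ^ 2 - -1 * p.2)) -
      e (-1) * (e (-p.1 ^ 2 - 3 * p.1) * e (-p.2 ^ 2 - -3 * p.2)) := by
    simp only [pow_two (e _), mul_sub, ← AddChar.map_add_eq_mul]
    congr 2 <;> ring
  have h₁ : 1 + (1 : R) ^ 2 * h = 2 + h + -1 := by ring
  have h₃ : -1 + (3 : R) ^ 2 * h = 2 + h + 1 := by linear_combination 4 * hh
  rw [sum_congr rfl fun p _ => split p, sum_sub_distrib, key, key, h₁, h₃,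
    e.map_add_eq_mul _ 1, e.map_add_eq_mul _ (-1)]
  ring

end CharacterSums

theorem val_sub_one_add_one {N : ℕ} [NeZero N] {m : ZMod N} (hm : m ≠ 0) :
    (m - 1).val + 1 = m.val := by
  have hpos : 0 < m.val := by rwa [ZMod.val_pos]
  have hlt := m.val_lt
  have h1 : (1 : ZMod N).val = 1 := ZMod.val_one'' (by omega)
  rw [ZMod.val_sub (by omega)]
  omega

theorem param_sum_neg (N : ℕ) [NeZero N] (x : ℕ → ℂ) {m : ZMod N} (hm : m ≠ 0) :
    x ((-m - 1).val + 1) + x (N - (-m - 1).val - 1) =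
      x ((m - 1).val + 1) + x (N - (m - 1).val - 1) := by
  have hlt := m.val_lt
  simp only [Nat.sub_sub, val_sub_one_add_one hm, val_sub_one_add_one (neg_ne_zero.2 hm),
    ZMod.neg_val, if_neg hm, Nat.sub_sub_self hlt.le]
  ring

theorem two_mul_half_sq_add_one (r : ℕ) :
    2 * ((((2 * r + 1) ^ 2 + 1) / 2 : ℕ) : ZMod (2 * r + 1)) = 1 := by
  have h : 2 * (((2 * r + 1) ^ 2 + 1) / 2) = (2 * r + 1) ^ 2 + 1 := by
    have : (2 * r + 1) ^ 2 + 1 = 2 * (2 * r ^ 2 + 2 * r + 1) := by ring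
    omega
  have h' := congrArg (Nat.cast : ℕ → ZMod (2 * r + 1)) h
  rw [Nat.cast_mul, Nat.cast_add, Nat.cast_pow, ZMod.natCast_self] at h'
  simpa using h'

theorem stdAddChar_one_sub_neg_one_ne_zero (r : ℕ) (hr : 1 ≤ r) :
    ZMod.stdAddChar (1 : ZMod (2 * r + 1)) - ZMod.stdAddChar (-1 : ZMod (2 * r + 1)) ≠ 0 := by
  rw [sub_ne_zero, ZMod.injective_stdAddChar.ne_iff]
  intro h
  have hv : (1 : ZMod (2 * r + 1)).val = 1 := ZMod.val_one'' (by omega)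
  have h10 : (1 : ZMod (2 * r + 1)) ≠ 0 := fun h0 => by simp [h0] at hv
  have hn := congrArg ZMod.val h
  rw [ZMod.neg_val, if_neg h10, hv] at hn
  omega

/-- The normalization constant
`z = Σ_{λ∈Λ} d_λ·q^{-λ₁(λ₁+1)-λ₂(λ₂-1)}·(q^{n_λ+1}-q^{-n_λ-1})/(q-q⁻¹)`
equals `-q³·G_{N-1}⁴/N²`; in particular it is independent of the parameters
`x₁, …, x_{N-1}` (with `N = 2r+1` odd and `q = exp(2πi/N)`). -/
theorem z_value_gl2 (r : ℕ) (hr : 1 ≤ r) (x : ℕ → ℂ) :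
    (∑ lam ∈ LamSet (2 * r + 1),
        dconst (2 * r + 1) x lam *
          qRoot (2 * r + 1) ^
            (-(lam.1 : ℤ) * ((lam.1 : ℤ) + 1) - (lam.2 : ℤ) * ((lam.2 : ℤ) - 1)) *
          ((qRoot (2 * r + 1) ^ ((nwt (2 * r + 1) lam : ℤ) + 1) -
              qRoot (2 * r + 1) ^ (-((nwt (2 * r + 1) lam : ℤ) + 1))) /
            (qRoot (2 * r + 1) - (qRoot (2 * r + 1))⁻¹)))
      = -(qRoot (2 * r + 1)) ^ 3 * (gauss (2 * r + 1) ((2 * r + 1 : ℤ) - 1)) ^ 4 /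
          ((2 * r + 1 : ℂ)) ^ 2 := by
  set N := 2 * r + 1 with hN
  have hcast : (2 * r + 1 : ℤ) = (N : ℤ) := by simp [hN]
  have hcastC : (2 * r + 1 : ℂ) = (N : ℂ) := by simp [hN]
  have hNC : (N : ℂ) ≠ 0 := NeZero.ne _
  rw [hcast, hcastC]
  set e := ZMod.stdAddChar (N := N)
  set h := (((N ^ 2 + 1) / 2 : ℕ) : ZMod N) with hh
  have h2 : 2 * h = 1 := two_mul_half_sq_add_one r
  have hD : e 1 - e (-1) ≠ 0 := stdAddChar_one_sub_neg_one_ne_zero r hr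
  have hq : qRoot N - (qRoot N)⁻¹ = e 1 - e (-1) := by
    have h₁ := qRoot_zpow N 1
    have h₂ := qRoot_zpow N (-1)
    simp only [zpow_one, zpow_neg, Int.cast_one, Int.cast_neg] at h₁ h₂
    rw [h₂, h₁]
  set g := gauss N ((N : ℤ) - 1) with hg
  have hg' : g = ∑ a : ZMod N, e (-a ^ 2) := gauss_neg_one_eq N
  let y : ZMod N → ℂ := fun m => x ((m - 1).val + 1) + x (N - (m - 1).val - 1)
  let C : ℂ := e h * (g / N) ^ 2 / (e 1 - e (-1))
  let T : ZMod N × ZMod N → ℂ := fun p =>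
    C * (e (-p.1 * (p.1 + 1) - p.2 * (p.2 - 1)) ^ 2 * e (p.1 ^ 2 + p.2 ^ 2) *
      (e (p.1 - p.2 + 1) - e (-(p.1 - p.2 + 1)))) +
    C * (e (-p.1 * (p.1 + 1) - p.2 * (p.2 - 1)) ^ 2 * y (p.1 - p.2 + 1) *
      (e (p.1 - p.2 + 1) - e (-(p.1 - p.2 + 1))))
  have hterm (lam : ℕ × ℕ) : dconst N x lam *
      qRoot N ^ (-(lam.1 : ℤ) * ((lam.1 : ℤ) + 1) - (lam.2 : ℤ) * ((lam.2 : ℤ) - 1)) *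
      ((qRoot N ^ ((nwt N lam : ℤ) + 1) - qRoot N ^ (-((nwt N lam : ℤ) + 1))) /
        (qRoot N - (qRoot N)⁻¹)) = T ((lam.1 : ZMod N), (lam.2 : ZMod N)) := by
    rw [hq, dconst, qRoot_pow]
    simp only [qRoot_zpow, nwt_eq_val, T, y, C]
    push_cast
    rw [ZMod.natCast_zmod_val, add_sub_cancel_right, ← hg, ← hh]
    ring
  have hT (lam : ℕ × ℕ) (hlam : nwt N lam = N - 1) :
      T ((lam.1 : ZMod N), (lam.2 : ZMod N)) = 0 := by
    have h0 : (lam.1 : ZMod N) - (lam.2 : ZMod N) + 1 = 0 := by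
      rw [← ZMod.natCast_zmod_val ((lam.1 : ZMod N) - (lam.2 : ZMod N)), ← nwt_eq_val, hlam,
        ← Nat.cast_add_one, Nat.sub_add_cancel (by omega), ZMod.natCast_self]
    simp only [T, h0, neg_zero, sub_self, mul_zero, add_zero]
  have hsum : ∑ lam ∈ LamSet N, T ((lam.1 : ZMod N), (lam.2 : ZMod N)) = ∑ p, T p := by
    rw [LamSet, sum_filter_of_ne fun lam _ => mt (hT lam), sum_product,
      Fintype.sum_prod_type, ← sum_range_eq_sum_zmod]
    exact sum_congr rfl fun i _ => sum_range_eq_sum_zmod N fun b => T ((i : ZMod N), b)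
  have hy : ∀ m ≠ 0, y (-m) = y m := fun m hm => param_sum_neg N x hm
  have hpow : e h * e (2 + h) = qRoot N ^ 3 := by
    rw [qRoot_pow, ← AddChar.map_add_eq_mul]
    congr 1
    push_cast
    linear_combination h2
  rw [sum_congr rfl fun lam _ => hterm lam, hsum, sum_add_distrib, ← mul_sum, ← mul_sum,
    sum_char_mul_even_eq_zero e y hy, sum_char_mul_char e h2, ← hg', ← hpow]
  simp only [C]
  field_simp
  ring

end
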